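/- arXiv:2507.03481 — 2 statements merged into one kernel-verified Lean document; each statement's English description precedes it below -/
import Mathlib

section
/- For every transmission rate t > 0 and every ε > 0 there exists n₀ such that for all n ≥ n₀ the following holds with k = ⌊tn⌋: for every composition Q ∈ 𝒫ₙ(𝒳) with |T^n(Q)| ≥ |𝒱^k|, there exists a joint source-channel code of parameters (k, n) with all codewords lying in T^n(Q) whose error probability satisfies p_e ≤ e^{nε} · exp( −n · sup_{ρ ≥ 1} { E_x(Q, ρ) − t·E_s(ρ, P_V) } ). -/
open scoped Classical BigOperators

noncomputable section

/-- `P` is a probability distribution on the finite alphabet `α`. -/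
def IsProbDist {α : Type} [Fintype α] (P : α → ℝ) : Prop :=
  (∀ a, 0 ≤ P a) ∧ ∑ a, P a = 1

/-- `W` is a discrete memoryless channel (a stochastic matrix). -/
def IsDMC {X Y : Type} [Fintype Y] (W : X → Y → ℝ) : Prop :=
  (∀ x y, 0 ≤ W x y) ∧ ∀ x, ∑ y, W x y = 1

/-- Product extension of a distribution: `P^k(v) = ∏ P(vᵢ)`. -/
def prodDist {α : Type} (P : α → ℝ) {k : ℕ} (v : Fin k → α) : ℝ := ∏ i, P (v i)

/-- Product extension of a channel: `W^n(y|x) = ∏ W(y_l|x_l)`. -/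
def Wn {X Y : Type} (W : X → Y → ℝ) {n : ℕ} (x : Fin n → X) (y : Fin n → Y) : ℝ :=
  ∏ l, W (x l) (y l)

/-- Shannon entropy (natural logarithm). -/
def entH {α : Type} [Fintype α] (P : α → ℝ) : ℝ := -∑ a, P a * Real.log (P a)

/-- Kullback–Leibler divergence `D(P‖Q)`. -/
def KL {α : Type} [Fintype α] (P Q : α → ℝ) : ℝ := ∑ a, P a * Real.log (P a / Q a)

/-- Empirical distribution (type) of a sequence. -/
def empDist {α : Type} [Fintype α] {k : ℕ} (v : Fin k → α) : α → ℝ :=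
  fun a => ((Finset.univ.filter fun i => v i = a).card : ℝ) / k

/-- Type class `T^k(P)`: sequences of length `k` with empirical distribution `P`. -/
def typeClass {α : Type} [Fintype α] (k : ℕ) (P : α → ℝ) : Finset (Fin k → α) :=
  Finset.univ.filter fun v => empDist v = P

/-- `P` is a type of length-`k` sequences, i.e. `P ∈ 𝒫ₖ(α)`. -/
def IsType {α : Type} [Fintype α] (k : ℕ) (P : α → ℝ) : Prop :=
  ∃ v : Fin k → α, empDist v = P

/-- Source reliability function `e(R, P_V) = min_{Q : H(Q) ≥ R} D(Q‖P_V)`. -/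
def srcRel {V : Type} [Fintype V] (PV : V → ℝ) (R : ℝ) : ℝ :=
  sInf { z | ∃ Q : V → ℝ, IsProbDist Q ∧ R ≤ entH Q ∧ z = KL Q PV }

/-- Bhattacharyya distance. -/
def dB {X Y : Type} [Fintype Y] (W : X → Y → ℝ) (x x' : X) : ℝ :=
  -Real.log (∑ y, Real.sqrt (W x y * W x' y))

/-- Mutual information of a joint distribution on `X × X`. -/
def mutualInfo {X : Type} [Fintype X] (P : X × X → ℝ) : ℝ :=
  ∑ p : X × X, P p * Real.log (P p / ((∑ x', P (p.1, x')) * (∑ x, P (x, p.2))))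

/-- Weak expurgated exponent `E'_ex(Q, R)`. -/
def Eex' {X Y : Type} [Fintype X] [Fintype Y] (W : X → Y → ℝ) (Q : X → ℝ) (R : ℝ) : ℝ :=
  sInf { z | ∃ P : X × X → ℝ, IsProbDist P ∧ (∀ x, ∑ x', P (x, x') = Q x) ∧
    mutualInfo P ≤ R ∧
    z = (∑ p : X × X, P p * dB W p.1 p.2) + mutualInfo P - R }

/-- Gallager source function `E_s(ρ, P_V)`. -/
def Es {α : Type} [Fintype α] (PV : α → ℝ) (ρ : ℝ) : ℝ :=
  (1 + ρ) * Real.log (∑ v, PV v ^ (1 / (1 + ρ)))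

/-- Dual weak expurgated function `E'_x(Q, ρ)`. -/
def Ex' {X Y : Type} [Fintype X] [Fintype Y] (W : X → Y → ℝ) (Q : X → ℝ) (ρ : ℝ) : ℝ :=
  sInf { z | ∃ Q' : X → ℝ, IsProbDist Q' ∧
    z = -ρ * ∑ x, Q x * Real.log (∑ x', Q' x' * Real.exp (-dB W x x' / ρ)) }

/-- Constant-composition expurgated dual function `E_x(Q, ρ)`. -/
def Ex {X Y : Type} [Fintype X] [Fintype Y] (W : X → Y → ℝ) (Q : X → ℝ) (ρ : ℝ) : ℝ :=
  sSup { z | ∃ a : X → ℝ,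
    z = -ρ * ∑ x, Q x * Real.log (∑ x', Q x' *
      (Real.exp (-dB W x x') * Real.exp (a x' - a x)) ^ (1 / ρ)) }

/-- Error probability of a joint source-channel code `(f, φ)`. -/
def pErr {V X Y : Type} [Fintype V] [Fintype X] [Fintype Y] (PV : V → ℝ)
    (W : X → Y → ℝ) {k n : ℕ}
    (f : (Fin k → V) → Fin n → X) (φ : (Fin n → Y) → Fin k → V) : ℝ :=
  ∑ v : Fin k → V, prodDist PV v *
    ∑ y ∈ Finset.univ.filter (fun y : Fin n → Y => φ y ≠ v), Wn W (f v) y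

/-- The set `Λ_c` of source types belonging to class `c` of the partition `cls`. -/
def classTypes {V : Type} [Fintype V] {k m : ℕ} (cls : (Fin k → V) → Fin m)
    (c : Fin m) : Finset (V → ℝ) :=
  Finset.image empDist (Finset.univ.filter fun v => cls v = c)

/-- An admissible partition of `𝒱^k`: classes are unions of source type classes, and
each class `c` carries a composition `Q_c ∈ 𝒫ₙ(𝒳)` whose type class is at least as
large as the class. -/
def AdmissiblePartition {V X : Type} [Fintype V] [Fintype X] (n : ℕ) {k m : ℕ}
    (cls : (Fin k → V) → Fin m) (Qc : Fin m → X → ℝ) : Prop :=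
  (∀ v v' : Fin k → V, empDist v = empDist v' → cls v = cls v') ∧
  (∀ c, IsType n (Qc c)) ∧
  (∀ c, (Finset.univ.filter fun v : Fin k → V => cls v = c).card ≤ (typeClass n (Qc c)).card)


lemma aux_sum_rpow {ι : Type*} (s : Finset ι) (g : ι → ℝ) (hg : ∀ i ∈ s, 0 ≤ g i) (ρ : ℝ)
    (hρ : 1 ≤ ρ) : ∑ i ∈ s, g i ^ ρ ≤ (∑ i ∈ s, g i) ^ ρ := by
  induction s using Finset.induction_on with
  | empty => simp [Real.zero_rpow (by linarith : ρ ≠ 0)]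
  | insert a s ha ih =>
    rw [Finset.sum_insert ha, Finset.sum_insert ha]
    have h1 := ih (fun i hi => hg i (Finset.mem_insert_of_mem hi))
    have h2 : 0 ≤ ∑ i ∈ s, g i :=
      Finset.sum_nonneg (fun i hi => hg i (Finset.mem_insert_of_mem hi))
    have h3 := Real.add_rpow_le_rpow_add (hg a (Finset.mem_insert_self _ _)) h2 hρ
    linarith

lemma aux_sqrt_le (p q ρ : ℝ) (hp : 0 ≤ p) (hpq : p ≤ q) (hρ : 1 ≤ ρ) :
    Real.sqrt (p * q) ≤ p ^ (1 / (1 + ρ)) * (q ^ (1 / (1 + ρ))) ^ ρ := by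
  rcases hp.eq_or_lt with h | h
  · subst h
    simp only [zero_mul, Real.sqrt_zero]
    positivity
  · have hq : 0 < q := h.trans_le hpq
    have h1 : Real.sqrt (p * q) = p ^ (1 / (1 + ρ)) * p ^ ((ρ - 1) / (2 * (1 + ρ))) *
        q ^ ((1:ℝ)/2) := by
      rw [← Real.rpow_add h, Real.sqrt_eq_rpow, Real.mul_rpow hp hq.le]
      congr 2
      field_simp
      ring
    have h2 : (q ^ (1 / (1 + ρ))) ^ ρ = q ^ ((ρ - 1) / (2 * (1 + ρ))) * q ^ ((1:ℝ)/2) := by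
      rw [← Real.rpow_add hq, ← Real.rpow_mul hq.le]
      congr 1
      field_simp
      ring
    rw [h1, h2, mul_assoc]
    have : 0 ≤ (ρ - 1) / (2 * (1 + ρ)) := div_nonneg (by linarith) (by linarith)
    gcongr

lemma aux_avg {C ι : Type*} (T : Finset C) (hT : T.Nonempty) (s : Finset ι)
    (w : ι → ℝ) (hw : ∀ i, 0 ≤ w i) (g : ι → C → ℝ) (M : ℝ)
    (hg : ∀ i ∈ s, ∑ x ∈ T, g i x ≤ M * T.card) :
    ∃ x ∈ T, ∑ i ∈ s, w i * g i x ≤ M * ∑ i ∈ s, w i := by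
  apply Finset.exists_le_of_sum_le hT
  rw [Finset.sum_comm]
  simp only [Finset.sum_const, nsmul_eq_mul]
  rw [← mul_assoc, Finset.mul_sum]
  apply Finset.sum_le_sum
  intro i hi
  rw [← Finset.mul_sum]
  nlinarith [mul_le_mul_of_nonneg_left (hg i hi) (hw i)]

lemma aux_greedy {ι C : Type} [Fintype ι] (p : ι → ℝ) (hp : ∀ i, 0 ≤ p i)
    (T : Finset C) (hT : T.Nonempty) (K : C → C → ℝ) (hK : ∀ x y, 0 ≤ K x y)
    (hKs : ∀ x y, K x y = K y x) (ρ : ℝ) (hρ : 1 ≤ ρ) (M : ℝ) (hM : 0 ≤ M)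
    (hKM : ∀ x' ∈ T, ∑ x ∈ T, K x x' ^ (1 / ρ) ≤ M * T.card) :
    ∃ f : ι → C, (∀ i, f i ∈ T) ∧
      ∑ v, ∑ v' ∈ Finset.univ.filter (fun v' => v' ≠ v),
        Real.sqrt (p v * p v') * K (f v) (f v') ≤
      2 * (M ^ ρ * (∑ v, p v ^ (1 / (1 + ρ))) ^ (1 + ρ)) := by
  set S := ∑ v, p v ^ (1 / (1 + ρ)) with hS
  have hS0 : 0 ≤ S := Finset.sum_nonneg (fun i _ => Real.rpow_nonneg (hp i) _)
  have key : ∀ s : Finset ι, ∃ f : ι → C, (∀ i, f i ∈ T) ∧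
      ∑ v ∈ s, ∑ v' ∈ s.filter (fun v' => v' ≠ v),
        Real.sqrt (p v * p v') * K (f v) (f v') ≤
      2 * (M ^ ρ * S ^ ρ) * ∑ v ∈ s, p v ^ (1 / (1 + ρ)) := by
    intro s
    induction s using Finset.induction_on_min_value p with
    | empty =>
      obtain ⟨x, hx⟩ := hT
      exact ⟨fun _ => x, fun _ => hx, by simp⟩
    | insert a s ha hmin ih =>
      obtain ⟨f, hf, hfs⟩ := ih
      obtain ⟨x, hx, hxs⟩ := aux_avg T hT s (fun i => p i ^ (1 / (1 + ρ)))
        (fun i => Real.rpow_nonneg (hp i) _) (fun i x => K x (f i) ^ (1 / ρ)) M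
        (fun i _ => hKM (f i) (hf i))
      refine ⟨Function.update f a x, ?_, ?_⟩
      · intro i
        by_cases h : i = a
        · subst h; simpa using hx
        · simpa [h] using hf i
      · have hne : ∀ v ∈ s, v ≠ a := fun v hv h => ha (h ▸ hv)
        have e1 : (insert a s).filter (fun v' => v' ≠ a) = s := by
          ext v; simp only [Finset.mem_filter, Finset.mem_insert]
          constructor
          · rintro ⟨h | h, h'⟩
            · exact absurd h h'
            · exact h
          · intro h; exact ⟨Or.inr h, hne v h⟩
        have e2 : ∀ v ∈ s, (insert a s).filter (fun v' => v' ≠ v) =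
            insert a (s.filter (fun v' => v' ≠ v)) := by
          intro v hv
          rw [Finset.filter_insert, if_pos (hne v hv).symm]
        have hnew : ∑ v ∈ s, Real.sqrt (p a * p v) * K x (f v) ≤
            p a ^ (1 / (1 + ρ)) * (M ^ ρ * S ^ ρ) := by
          calc ∑ v ∈ s, Real.sqrt (p a * p v) * K x (f v)
              ≤ ∑ v ∈ s, p a ^ (1 / (1 + ρ)) *
                (p v ^ (1 / (1 + ρ)) * K x (f v) ^ (1 / ρ)) ^ ρ := by
                apply Finset.sum_le_sum
                intro v hv
                rw [Real.mul_rpow (Real.rpow_nonneg (hp v) _) (Real.rpow_nonneg (hK _ _) _),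
                  ← Real.rpow_mul (hK _ _), one_div_mul_cancel (by linarith), Real.rpow_one,
                  ← mul_assoc]
                exact mul_le_mul_of_nonneg_right (aux_sqrt_le _ _ _ (hp a) (hmin v hv) hρ) (hK _ _)
            _ = p a ^ (1 / (1 + ρ)) * ∑ v ∈ s,
                (p v ^ (1 / (1 + ρ)) * K x (f v) ^ (1 / ρ)) ^ ρ := by rw [Finset.mul_sum]
            _ ≤ p a ^ (1 / (1 + ρ)) * (M * S) ^ ρ := by
                apply mul_le_mul_of_nonneg_left _ (Real.rpow_nonneg (hp a) _)
                have hnn : ∀ v ∈ s, 0 ≤ p v ^ (1 / (1 + ρ)) * K x (f v) ^ (1 / ρ) := fun v _ =>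
                  mul_nonneg (Real.rpow_nonneg (hp v) _) (Real.rpow_nonneg (hK _ _) _)
                refine (aux_sum_rpow _ _ hnn ρ hρ).trans ?_
                apply Real.rpow_le_rpow (Finset.sum_nonneg hnn) _ (by linarith)
                refine hxs.trans ?_
                apply mul_le_mul_of_nonneg_left _ hM
                exact Finset.sum_le_sum_of_subset_of_nonneg (Finset.subset_univ _)
                  (fun i _ _ => Real.rpow_nonneg (hp i) _)
            _ = _ := by rw [Real.mul_rpow hM hS0]
        rw [Finset.sum_insert ha, Finset.sum_insert ha, e1]
        have h1 : ∑ v' ∈ s, Real.sqrt (p a * p v') *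
            K (Function.update f a x a) (Function.update f a x v') =
            ∑ v ∈ s, Real.sqrt (p a * p v) * K x (f v) := by
          apply Finset.sum_congr rfl
          intro v hv
          simp [hne v hv]
        have h2 : ∑ v ∈ s, ∑ v' ∈ (insert a s).filter (fun v' => v' ≠ v),
            Real.sqrt (p v * p v') * K (Function.update f a x v) (Function.update f a x v') =
            ∑ v ∈ s, Real.sqrt (p a * p v) * K x (f v) +
            ∑ v ∈ s, ∑ v' ∈ s.filter (fun v' => v' ≠ v),
              Real.sqrt (p v * p v') * K (f v) (f v') := by
          rw [← Finset.sum_add_distrib]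
          apply Finset.sum_congr rfl
          intro v hv
          rw [e2 v hv, Finset.sum_insert (by simp [ha])]
          congr 1
          · simp [hne v hv, mul_comm (p v), hKs (f v)]
          · apply Finset.sum_congr rfl
            intro v' hv'
            simp [hne v hv, hne v' (Finset.mem_filter.1 hv').1]
        rw [h1, h2]
        linarith
  obtain ⟨f, hf, h⟩ := key Finset.univ
  refine ⟨f, hf, h.trans (le_of_eq ?_)⟩
  rw [← hS, Real.rpow_add' hS0 (by linarith), Real.rpow_one]
  ring

lemma aux_factorial (m n : ℕ) (h : m ≤ n) :
    (m.factorial : ℝ) ≤ Real.exp 1 * (n + 1) * ((m : ℝ) / Real.exp 1) ^ m := by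
  have hn : (1:ℝ) ≤ n + 1 := by have : (0:ℝ) ≤ n := Nat.cast_nonneg n
                                linarith
  rcases m with _ | m
  · simp
    nlinarith [Real.exp_one_gt_d9]
  · have h1 := Stirling.stirlingSeq'_antitone (Nat.zero_le m)
    simp only [Function.comp] at h1
    rw [show Nat.succ 0 = 1 from rfl, Stirling.stirlingSeq_one, Stirling.stirlingSeq,
      div_le_iff₀ (by positivity)] at h1
    refine h1.trans ?_
    rw [← mul_assoc]
    apply mul_le_mul_of_nonneg_right _ (by positivity)
    rw [Real.sqrt_mul (by norm_num), div_mul_eq_mul_div, ← mul_assoc, mul_right_comm,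
      mul_div_assoc, mul_comm (Real.exp 1 * _)]
    have : √2 ≠ 0 := by positivity
    field_simp
    rw [Real.sqrt_le_left (by positivity)]
    have h3 : ((m + 1 : ℕ):ℝ) ≤ n := by exact_mod_cast h
    simp only [Nat.succ_eq_add_one]
    nlinarith

lemma aux_count {X : Type} [Fintype X] {n : ℕ} (x : Fin n → X) :
    (n.factorial : ℝ) ≤ (typeClass n (empDist x)).card *
      ∏ a, ((Finset.univ.filter fun i => x i = a).card.factorial : ℝ) := by
  have hmap : ∀ g ∈ (Finset.univ : Finset (Equiv.Perm (Fin n))),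
      x ∘ g ∈ typeClass n (empDist x) := by
    intro g _
    simp only [typeClass, Finset.mem_filter, Finset.mem_univ, true_and]
    funext a
    simp only [empDist]
    congr 2
    apply Finset.card_bij (fun i _ => g i)
    · intro i hi; simpa using hi
    · intro i _ j _ h; exact g.injective h
    · intro j hj; exact ⟨g.symm j, by simpa using hj, by simp⟩
  have hstab : Fintype.card {g : Equiv.Perm (Fin n) // x ∘ g = x} =
      ∏ a, (Finset.univ.filter fun i => x i = a).card.factorial := by
    rw [DomMulAct.stabilizer_card]
    apply Finset.prod_congr rfl
    intro a _
    rw [Fintype.card_subtype]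
  have := Finset.card_le_mul_card_image_of_maps_to hmap
    (∏ a, (Finset.univ.filter fun i => x i = a).card.factorial) (by
      intro b _
      rw [← hstab]
      rcases (Finset.univ.filter fun g : Equiv.Perm (Fin n) => x ∘ g = b).eq_empty_or_nonempty
        with h | ⟨g₀, hg₀⟩
      · rw [h]; simp
      · rw [Fintype.card_subtype]
        apply Finset.card_le_card_of_injOn (fun g => g * g₀⁻¹)
        · intro g hg
          simp only [Finset.coe_filter, Finset.mem_univ, true_and, Set.mem_ofPred_eq,
            Finset.mem_filter] at hg hg₀ ⊢
          funext i
          have h1 := congrFun hg (g₀⁻¹ i)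
          have h2 := congrFun hg₀ (g₀⁻¹ i)
          simp only [Function.comp, Equiv.Perm.coe_mul, Equiv.Perm.inv_def, Equiv.apply_symm_apply] at h1 h2 ⊢
          rw [h1, h2]
        · intro g _ g' _ h
          exact mul_right_cancel h)
  rw [Finset.card_univ, Fintype.card_perm, Fintype.card_fin, mul_comm] at this
  exact_mod_cast this

/-- Lower bound on the probability of the own type class. -/
lemma aux_typeProb {X : Type} [Fintype X] {n : ℕ} (hn : 0 < n) (x : Fin n → X) :
    1 ≤ (Real.exp 1 * (n + 1)) ^ (Fintype.card X) *
      ((typeClass n (empDist x)).card * ∏ l, empDist x (x l)) := by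
  have h1 := aux_count x
  set c : X → ℕ := fun a => (Finset.univ.filter fun i => x i = a).card with hc
  have hcn : ∀ a, c a ≤ n := fun a => by
    simpa using Finset.card_le_univ (Finset.univ.filter fun i => x i = a)
  have hsum : ∑ a, c a = n := by
    have := Finset.card_eq_sum_card_fiberwise (f := x) (s := Finset.univ) (t := Finset.univ)
      (by intro i _; simp)
    simpa [hc] using this.symm
  have hprod : ∏ l, empDist x (x l) = ∏ a, ((c a : ℝ) / n) ^ (c a) := by
    rw [← Finset.prod_fiberwise_of_maps_to (s := Finset.univ) (t := Finset.univ) (g := x)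
      (by intro i _; simp)]
    apply Finset.prod_congr rfl
    intro a _
    rw [Finset.prod_congr rfl (g := fun _ => (c a : ℝ) / n), Finset.prod_const]
    intro i hi
    simp only [Finset.mem_filter, Finset.mem_univ, true_and] at hi
    rw [hi]; rfl
  have hn' : (0:ℝ) < n := by exact_mod_cast hn
  have h2 : ∏ a, ((c a).factorial : ℝ) ≤ (Real.exp 1 * (n + 1)) ^ (Fintype.card X) *
      (((n:ℝ) / Real.exp 1) ^ n * ∏ l, empDist x (x l)) := by
    calc ∏ a, ((c a).factorial : ℝ)
        ≤ ∏ a, (Real.exp 1 * (n + 1) * ((c a : ℝ) / Real.exp 1) ^ (c a)) := by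
          apply Finset.prod_le_prod
          · intros; positivity
          · intro a _; exact aux_factorial _ _ (hcn a)
      _ = _ := by
          rw [Finset.prod_mul_distrib, Finset.prod_const, Finset.card_univ, hprod]
          congr 1
          conv_rhs => rw [← hsum, ← Finset.prod_pow_eq_pow_sum, hsum, ← Finset.prod_mul_distrib]
          apply Finset.prod_congr rfl
          intro a _
          rw [← mul_pow]
          congr 1
          field_simp
  have h3 : ((n:ℝ) / Real.exp 1) ^ n ≤ n.factorial := by
    have := Real.pow_div_factorial_le_exp (n:ℝ) hn'.le n
    rw [div_le_iff₀ (by positivity)] at this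
    rw [div_pow, div_le_iff₀ (by positivity), ← Real.exp_nat_mul, mul_one]
    linarith
  have hpos : 0 < ((n:ℝ) / Real.exp 1) ^ n := by positivity
  have h4 : ((n:ℝ) / Real.exp 1) ^ n * 1 ≤ ((n:ℝ) / Real.exp 1) ^ n *
    ((Real.exp 1 * (n + 1)) ^ (Fintype.card X) *
      ((typeClass n (empDist x)).card * ∏ l, empDist x (x l))) := by
    rw [mul_one]
    refine (h3.trans h1).trans ?_
    refine (mul_le_mul_of_nonneg_left h2 (Nat.cast_nonneg _)).trans (le_of_eq ?_)
    ring
  exact le_of_mul_le_mul_left h4 hpos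

lemma aux_bc_le {X Y : Type} [Fintype Y] (W : X → Y → ℝ) (x x' : X) :
    ∑ y, Real.sqrt (W x y * W x' y) ≤ Real.exp (-dB W x x') := by
  have h0 : 0 ≤ ∑ y, Real.sqrt (W x y * W x' y) :=
    Finset.sum_nonneg (fun _ _ => Real.sqrt_nonneg _)
  rcases h0.eq_or_lt with h | h
  · rw [← h]; positivity
  · rw [dB, neg_neg, Real.exp_log h]

lemma aux_dB_nonneg {X Y : Type} [Fintype Y] (W : X → Y → ℝ) (hW : IsDMC W) (x x' : X) :
    0 ≤ dB W x x' := by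
  have h0 : 0 ≤ ∑ y, Real.sqrt (W x y * W x' y) :=
    Finset.sum_nonneg (fun _ _ => Real.sqrt_nonneg _)
  have h1 : ∑ y, Real.sqrt (W x y * W x' y) ≤ 1 := by
    calc ∑ y, Real.sqrt (W x y * W x' y) ≤ ∑ y, (W x y + W x' y) / 2 := by
          apply Finset.sum_le_sum
          intro y _
          have a := hW.1 x y
          have b := hW.1 x' y
          rw [Real.sqrt_le_left (by linarith)]
          nlinarith [sq_nonneg (W x y - W x' y)]
      _ = 1 := by
          rw [← Finset.sum_div, Finset.sum_add_distrib, hW.2, hW.2]; norm_num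
  have := Real.log_nonpos h0 h1
  rw [dB]; linarith

lemma aux_dB_symm {X Y : Type} [Fintype Y] (W : X → Y → ℝ) (x x' : X) :
    dB W x x' = dB W x' x := by
  simp only [dB, mul_comm]

lemma aux_sqrt_prod {ι : Type*} (s : Finset ι) (g : ι → ℝ) (hg : ∀ i ∈ s, 0 ≤ g i) :
    Real.sqrt (∏ i ∈ s, g i) = ∏ i ∈ s, Real.sqrt (g i) := by
  simp only [Real.sqrt_eq_rpow]
  exact (Real.finsetProd_rpow s g hg _).symm

lemma aux_bcn {X Y : Type} [Fintype Y] (W : X → Y → ℝ) (hW : IsDMC W) {n : ℕ}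
    (x x' : Fin n → X) :
    ∑ y : Fin n → Y, Real.sqrt (Wn W x y * Wn W x' y) ≤
      ∏ l, Real.exp (-dB W (x l) (x' l)) := by
  have h : ∑ y : Fin n → Y, Real.sqrt (Wn W x y * Wn W x' y) =
      ∏ l, ∑ y, Real.sqrt (W (x l) y * W (x' l) y) := by
    rw [Finset.prod_univ_sum, Fintype.piFinset_univ]
    apply Finset.sum_congr rfl
    intro y _
    rw [Wn, Wn, ← Finset.prod_mul_distrib, aux_sqrt_prod]
    intro i _
    exact mul_nonneg (hW.1 _ _) (hW.1 _ _)
  rw [h]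
  apply Finset.prod_le_prod
  · intro l _; exact Finset.sum_nonneg (fun _ _ => Real.sqrt_nonneg _)
  · intro l _; exact aux_bc_le W _ _

/-- MAP decoding bound. -/
lemma aux_map {V X Y : Type} [Fintype V] [Nonempty V] [Fintype X] [Fintype Y] (PV : V → ℝ)
    (hP : ∀ v, 0 ≤ PV v) (W : X → Y → ℝ) (hW : IsDMC W) {k n : ℕ}
    (f : (Fin k → V) → Fin n → X) :
    ∃ φ : (Fin n → Y) → Fin k → V, pErr PV W f φ ≤
      ∑ v, ∑ v' ∈ Finset.univ.filter (fun v' => v' ≠ v),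
        Real.sqrt (prodDist PV v * prodDist PV v') *
          ∏ l, Real.exp (-dB W (f v l) (f v' l)) := by
  have hp : ∀ v : Fin k → V, 0 ≤ prodDist PV v := fun v => Finset.prod_nonneg (fun i _ => hP _)
  have hw : ∀ x (y : Fin n → Y), 0 ≤ Wn W x y := fun x y =>
    Finset.prod_nonneg (fun i _ => hW.1 _ _)
  have hex : ∀ y : Fin n → Y, ∃ v : Fin k → V, ∀ v', prodDist PV v' * Wn W (f v') y ≤
      prodDist PV v * Wn W (f v) y := fun y => by
    obtain ⟨v, _, hv⟩ := Finset.exists_max_image (Finset.univ : Finset (Fin k → V))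
      (fun v => prodDist PV v * Wn W (f v) y) Finset.univ_nonempty
    exact ⟨v, fun v' => hv v' (Finset.mem_univ _)⟩
  choose φ hφ using hex
  refine ⟨φ, ?_⟩
  unfold pErr
  apply Finset.sum_le_sum
  intro v _
  calc prodDist PV v * ∑ y ∈ Finset.univ.filter (fun y : Fin n → Y => φ y ≠ v), Wn W (f v) y
      ≤ ∑ y ∈ Finset.univ.filter (fun y : Fin n → Y => φ y ≠ v),
        ∑ v' ∈ Finset.univ.filter (fun v' => v' ≠ v),
        Real.sqrt (prodDist PV v * prodDist PV v') *
          Real.sqrt (Wn W (f v) y * Wn W (f v') y) := by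
        rw [Finset.mul_sum]
        apply Finset.sum_le_sum
        intro y hy
        have hne : φ y ≠ v := by simpa using hy
        refine le_trans ?_ (Finset.single_le_sum
          (f := fun v' => Real.sqrt (prodDist PV v * prodDist PV v') *
          Real.sqrt (Wn W (f v) y * Wn W (f v') y))
          (fun v' _ => mul_nonneg (Real.sqrt_nonneg _) (Real.sqrt_nonneg _))
          (by simpa using hne : φ y ∈ Finset.univ.filter (fun v' => v' ≠ v)))
        rw [← Real.sqrt_mul (mul_nonneg (hp _) (hp _))]
        apply Real.le_sqrt_of_sq_le
        have h1 := hφ y v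
        have h2 : 0 ≤ prodDist PV v * Wn W (f v) y := mul_nonneg (hp _) (hw _ _)
        nlinarith [mul_le_mul_of_nonneg_left h1 h2]
    _ ≤ ∑ y : Fin n → Y,
        ∑ v' ∈ Finset.univ.filter (fun v' => v' ≠ v),
        Real.sqrt (prodDist PV v * prodDist PV v') *
          Real.sqrt (Wn W (f v) y * Wn W (f v') y) := by
        apply Finset.sum_le_sum_of_subset_of_nonneg (Finset.subset_univ _)
        intro y _ _
        exact Finset.sum_nonneg (fun v' _ => mul_nonneg (Real.sqrt_nonneg _) (Real.sqrt_nonneg _))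
    _ ≤ _ := by
        rw [Finset.sum_comm]
        apply Finset.sum_le_sum
        intro v' _
        rw [← Finset.mul_sum]
        exact mul_le_mul_of_nonneg_left (aux_bcn W hW _ _) (Real.sqrt_nonneg _)

lemma aux_empDist_prob {X : Type} [Fintype X] {n : ℕ} (hn : 0 < n) (x : Fin n → X) :
    IsProbDist (empDist x) := by
  refine ⟨fun a => by unfold empDist; positivity, ?_⟩
  have hn' : (n:ℝ) ≠ 0 := by positivity
  unfold empDist
  rw [← Finset.sum_div, div_eq_one_iff_eq hn']
  have := Finset.card_eq_sum_card_fiberwise (f := x) (s := Finset.univ) (t := Finset.univ)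
      (by intro i _; simp)
  rw [Finset.card_univ, Fintype.card_fin] at this
  exact_mod_cast this.symm

lemma aux_sum_emp {X : Type} [Fintype X] {n : ℕ} (hn : 0 < n) (x : Fin n → X) (h : X → ℝ) :
    ∑ l, h (x l) = n * ∑ a, empDist x a * h a := by
  have hn' : (n:ℝ) ≠ 0 := by positivity
  rw [← Finset.sum_fiberwise_of_maps_to (s := Finset.univ) (t := Finset.univ) (g := x)
      (by intro i _; simp), Finset.mul_sum]
  apply Finset.sum_congr rfl
  intro a _
  rw [Finset.sum_congr rfl (g := fun _ => h a), Finset.sum_const, nsmul_eq_mul]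
  · unfold empDist; field_simp
  · intro i hi
    simp only [Finset.mem_filter, Finset.mem_univ, true_and] at hi
    rw [hi]

def gfun {X Y : Type} [Fintype X] [Fintype Y] (W : X → Y → ℝ) (Q : X → ℝ) (ρ : ℝ)
    (a : X → ℝ) (x : X) : ℝ :=
  ∑ x', Q x' * (Real.exp (-dB W x x') * Real.exp (a x' - a x)) ^ (1 / ρ)

lemma aux_gfun_pos {X Y : Type} [Fintype X] [Fintype Y] (W : X → Y → ℝ) (Q : X → ℝ)
    (hQ : IsProbDist Q) (ρ : ℝ) (a : X → ℝ) (x : X) : 0 < gfun W Q ρ a x := by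
  have hnn : ∀ x' ∈ Finset.univ,
      0 ≤ Q x' * (Real.exp (-dB W x x') * Real.exp (a x' - a x)) ^ (1 / ρ) :=
    fun x' _ => mul_nonneg (hQ.1 _) (by positivity)
  refine (Finset.sum_nonneg hnn).lt_of_ne (fun h => ?_)
  have h2 := (Finset.sum_eq_zero_iff_of_nonneg hnn).1 h.symm
  have h3 : ∑ x', Q x' = 0 := Finset.sum_eq_zero (fun x' hx' => by
    have := h2 x' hx'
    rcases mul_eq_zero.1 this with h | h
    · exact h
    · exact absurd h (by positivity))
  rw [hQ.2] at h3
  exact one_ne_zero h3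

lemma aux_channel {X Y : Type} [Fintype X] [Fintype Y] (W : X → Y → ℝ) {n : ℕ} (hn : 0 < n)
    (Q : X → ℝ) (ρ : ℝ) (a : X → ℝ) (x' : Fin n → X) (hx' : x' ∈ typeClass n Q) :
    ∑ x ∈ typeClass n Q, (∏ l, Real.exp (-dB W (x l) (x' l))) ^ (1 / ρ) ≤
      ((Real.exp 1 * (n + 1)) ^ (Fintype.card X) *
        Real.exp (n * ∑ x, Q x * Real.log (gfun W Q ρ a x))) * (typeClass n Q).card := by
  have hxQ : empDist x' = Q := by simpa [typeClass] using hx'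
  have hQ : IsProbDist Q := hxQ ▸ aux_empDist_prob hn x'
  have htp := aux_typeProb hn x'
  rw [hxQ] at htp
  set q := ∏ l, Q (x' l) with hq
  set L := (Real.exp 1 * ((n:ℝ) + 1)) ^ (Fintype.card X) with hL
  have hL0 : 0 < L := by positivity
  have hq0 : 0 ≤ q := Finset.prod_nonneg (fun _ _ => hQ.1 _)
  have hqx : ∀ x ∈ typeClass n Q, ∏ l, Q (x l) = q := by
    intro x hx
    have hx1 : empDist x = Q := by simpa [typeClass] using hx
    have hn' : (n:ℝ) ≠ 0 := by positivity
    have key : ∀ z : Fin n → X, empDist z = Q → ∏ l, Q (z l) =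
        ∏ b, Q b ^ ((n:ℝ) * Q b) := by
      intro z hz
      rw [← Finset.prod_fiberwise_of_maps_to (s := Finset.univ) (t := Finset.univ) (g := z)
        (by intro i _; simp)]
      apply Finset.prod_congr rfl
      intro b _
      rw [Finset.prod_congr rfl (g := fun _ => Q b), Finset.prod_const]
      · have : (n:ℝ) * Q b = ((Finset.univ.filter fun i => z i = b).card : ℝ) := by
          rw [← hz]; unfold empDist; field_simp
        rw [this, Real.rpow_natCast]
      · intro i hi
        simp only [Finset.mem_filter, Finset.mem_univ, true_and] at hi
        rw [hi]
    rw [hq, key x hx1, key x' hxQ]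
  have ha : ∀ x ∈ typeClass n Q, ∏ l, Real.exp (a (x l) - a (x' l)) = 1 := by
    intro x hx
    have hx1 : empDist x = Q := by simpa [typeClass] using hx
    rw [← Real.exp_sum, Finset.sum_sub_distrib, aux_sum_emp hn x a, aux_sum_emp hn x' a, hx1, hxQ]
    simp
  have hmain : q * ∑ x ∈ typeClass n Q, (∏ l, Real.exp (-dB W (x l) (x' l))) ^ (1 / ρ) ≤
      Real.exp (n * ∑ x, Q x * Real.log (gfun W Q ρ a x)) := by
    calc q * ∑ x ∈ typeClass n Q, (∏ l, Real.exp (-dB W (x l) (x' l))) ^ (1 / ρ)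
        = ∑ x ∈ typeClass n Q, ∏ l, (Q (x l) *
            (Real.exp (-dB W (x' l) (x l)) * Real.exp (a (x l) - a (x' l))) ^ (1 / ρ)) := by
          rw [Finset.mul_sum]
          apply Finset.sum_congr rfl
          intro x hx
          rw [Finset.prod_mul_distrib, hqx x hx,
            Real.finsetProd_rpow _ _ (fun _ _ => by positivity), Finset.prod_mul_distrib,
            ha x hx, mul_one]
          simp only [aux_dB_symm W (x' _)]
      _ ≤ ∑ x : Fin n → X, ∏ l, (Q (x l) *
            (Real.exp (-dB W (x' l) (x l)) * Real.exp (a (x l) - a (x' l))) ^ (1 / ρ)) := by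
          apply Finset.sum_le_sum_of_subset_of_nonneg (Finset.subset_univ _)
          intro x _ _
          exact Finset.prod_nonneg (fun l _ => mul_nonneg (hQ.1 _) (by positivity))
      _ = ∏ l, gfun W Q ρ a (x' l) := by
          unfold gfun
          rw [Finset.prod_univ_sum, Fintype.piFinset_univ]
      _ = _ := by
          rw [← hxQ, ← aux_sum_emp hn x' (fun b => Real.log (gfun W (empDist x') ρ a b)),
            Real.exp_sum]
          apply Finset.prod_congr rfl
          intro l _
          rw [Real.exp_log (aux_gfun_pos W _ (hxQ ▸ hQ) ρ a _)]
  have hS0 : 0 ≤ ∑ x ∈ typeClass n Q, (∏ l, Real.exp (-dB W (x l) (x' l))) ^ (1 / ρ) :=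
    Finset.sum_nonneg (fun _ _ => by positivity)
  calc ∑ x ∈ typeClass n Q, (∏ l, Real.exp (-dB W (x l) (x' l))) ^ (1 / ρ)
      ≤ (L * ((typeClass n Q).card * q)) *
        ∑ x ∈ typeClass n Q, (∏ l, Real.exp (-dB W (x l) (x' l))) ^ (1 / ρ) :=
        le_mul_of_one_le_left hS0 htp
    _ = (L * (typeClass n Q).card) *
        (q * ∑ x ∈ typeClass n Q, (∏ l, Real.exp (-dB W (x l) (x' l))) ^ (1 / ρ)) := by ring
    _ ≤ (L * (typeClass n Q).card) * Real.exp (n * ∑ x, Q x * Real.log (gfun W Q ρ a x)) :=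
        mul_le_mul_of_nonneg_left hmain (by positivity)
    _ = _ := by ring

lemma aux_code {V X Y : Type} [Fintype V] [Nonempty V] [Fintype X] [Fintype Y]
    (PV : V → ℝ) (hPV : IsProbDist PV) (W : X → Y → ℝ) (hW : IsDMC W)
    {n : ℕ} (hn : 0 < n) (k : ℕ) (Q : X → ℝ) (hQ : IsType n Q) (ρ : ℝ) (hρ : 1 ≤ ρ) (a : X → ℝ) :
    ∃ (f : (Fin k → V) → Fin n → X) (φ : (Fin n → Y) → Fin k → V),
      (∀ v, f v ∈ typeClass n Q) ∧
      pErr PV W f φ ≤ 2 * ((Real.exp 1 * (n + 1)) ^ (Fintype.card X)) ^ ρ *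
        Real.exp (-n * (-ρ * ∑ x, Q x * Real.log (gfun W Q ρ a x))) *
        Real.exp (k * Es PV ρ) := by
  obtain ⟨x₀, hx₀⟩ := hQ
  have hT : (typeClass n Q).Nonempty := ⟨x₀, by simp [typeClass, hx₀]⟩
  obtain ⟨f, hf, hfs⟩ := aux_greedy (fun v : Fin k → V => prodDist PV v)
    (fun v => Finset.prod_nonneg (fun i _ => hPV.1 _)) (typeClass n Q) hT
    (fun x x' : Fin n → X => ∏ l, Real.exp (-dB W (x l) (x' l)))
    (fun x y => by positivity)
    (fun x y => Finset.prod_congr rfl (fun l _ => by rw [aux_dB_symm])) ρ hρ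
    ((Real.exp 1 * (n + 1)) ^ (Fintype.card X) *
        Real.exp (n * ∑ x, Q x * Real.log (gfun W Q ρ a x))) (by positivity)
    (fun x' hx' => aux_channel W hn Q ρ a x' hx')
  obtain ⟨φ, hφ⟩ := aux_map PV hPV.1 W hW f
  refine ⟨f, φ, hf, hφ.trans (le_trans (le_of_eq ?_) (hfs.trans (le_of_eq ?_)))⟩
  · apply Finset.sum_congr rfl
    intro v _
    apply Finset.sum_congr _ (fun _ _ => rfl)
    ext v'
    simp only [Finset.mem_filter, Finset.mem_univ, true_and]
  have h1 : ∑ v : Fin k → V, prodDist PV v ^ (1 / (1 + ρ)) =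
      (∑ v, PV v ^ (1 / (1 + ρ))) ^ k := by
    have := Finset.prod_univ_sum (fun _ : Fin k => (Finset.univ : Finset V))
      (fun _ v => PV v ^ (1 / (1 + ρ)))
    rw [Fintype.piFinset_univ, Finset.prod_const, Finset.card_univ, Fintype.card_fin] at this
    rw [this]
    apply Finset.sum_congr rfl
    intro v _
    rw [prodDist, Real.finsetProd_rpow _ _ (fun _ _ => hPV.1 _)]
  have hS : 0 < ∑ v, PV v ^ (1 / (1 + ρ)) := by
    have hnn : ∀ v ∈ Finset.univ, 0 ≤ PV v ^ (1 / (1 + ρ)) :=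
      fun v _ => Real.rpow_nonneg (hPV.1 _) _
    refine (Finset.sum_nonneg hnn).lt_of_ne (fun h => ?_)
    have h2 := (Finset.sum_eq_zero_iff_of_nonneg hnn).1 h.symm
    have h3 : ∑ v, PV v = 0 := Finset.sum_eq_zero (fun v hv => by
      have := h2 v hv
      rw [Real.rpow_eq_zero (hPV.1 _) (by positivity)] at this
      exact this)
    rw [hPV.2] at h3
    exact one_ne_zero h3
  have h2 : ((∑ v, PV v ^ (1 / (1 + ρ))) ^ k) ^ (1 + ρ) = Real.exp (k * Es PV ρ) := by
    rw [← Real.rpow_natCast, ← Real.rpow_mul hS.le, Real.rpow_def_of_pos hS, Es]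
    congr 1; ring
  rw [h1, h2, Real.mul_rpow (by positivity) (by positivity), ← Real.exp_mul]
  rw [show (n:ℝ) * (∑ x, Q x * Real.log (gfun W Q ρ a x)) * ρ =
    -n * (-ρ * ∑ x, Q x * Real.log (gfun W Q ρ a x)) by ring]
  ring

lemma aux_val_le {X Y : Type} [Fintype X] [Fintype Y] (W : X → Y → ℝ) (hW : IsDMC W) (Q : X → ℝ)
    (hQ : IsProbDist Q) (ρ : ℝ) (hρ : 1 ≤ ρ) (a : X → ℝ) :
    -ρ * ∑ x, Q x * Real.log (gfun W Q ρ a x) ≤ ∑ x, ∑ x', dB W x x' := by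
  have hQ1 : ∀ x, Q x ≤ 1 := fun x => by
    rw [← hQ.2]; exact Finset.single_le_sum (fun i _ => hQ.1 i) (Finset.mem_univ x)
  have h1 : ∀ x, ∑ x', Q x' * ((1 / ρ) * (-dB W x x' + (a x' - a x))) ≤
      Real.log (gfun W Q ρ a x) := by
    intro x
    have := (strictConcaveOn_log_Ioi.concaveOn).le_map_sum (t := Finset.univ) (w := Q)
      (p := fun x' => (Real.exp (-dB W x x') * Real.exp (a x' - a x)) ^ (1 / ρ))
      (fun i _ => hQ.1 i) hQ.2 (fun i _ => by
        rw [Set.mem_Ioi]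
        positivity)
    simp only [smul_eq_mul] at this
    refine le_trans (le_of_eq ?_) this
    apply Finset.sum_congr rfl
    intro x' _
    rw [← Real.exp_add, Real.log_rpow (Real.exp_pos _), Real.log_exp]
  have h2 : ∑ x, Q x * ∑ x', Q x' * ((1 / ρ) * (-dB W x x' + (a x' - a x))) ≤
      ∑ x, Q x * Real.log (gfun W Q ρ a x) :=
    Finset.sum_le_sum (fun x _ => mul_le_mul_of_nonneg_left (h1 x) (hQ.1 x))
  have h3 : ∑ x, Q x * ∑ x', Q x' * ((1 / ρ) * (-dB W x x' + (a x' - a x))) =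
      -(1 / ρ) * ∑ x, ∑ x', Q x * Q x' * dB W x x' := by
    have e : ∀ x, Q x * ∑ x', Q x' * ((1 / ρ) * (-dB W x x' + (a x' - a x))) =
        -(1 / ρ) * ∑ x', Q x * Q x' * dB W x x' +
          (1 / ρ) * (Q x * ∑ x', Q x' * a x') - (1 / ρ) * (Q x * a x) * ∑ x', Q x' := by
      intro x
      simp only [Finset.mul_sum]
      rw [← Finset.sum_add_distrib, ← Finset.sum_sub_distrib]
      apply Finset.sum_congr rfl
      intros; ring
    rw [Finset.sum_congr rfl (fun x _ => e x), Finset.sum_sub_distrib, Finset.sum_add_distrib,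
      ← Finset.mul_sum, ← Finset.mul_sum, ← Finset.sum_mul, ← Finset.sum_mul, ← Finset.mul_sum,
      hQ.2]
    ring
  have h4 : ∑ x, ∑ x', Q x * Q x' * dB W x x' ≤ ∑ x, ∑ x', dB W x x' := by
    apply Finset.sum_le_sum; intro x _
    apply Finset.sum_le_sum; intro x' _
    apply mul_le_of_le_one_left (aux_dB_nonneg W hW _ _)
    exact mul_le_one₀ (hQ1 x) (hQ.1 _) (hQ1 _)
  rw [h3] at h2
  have h5 : ρ * (1 / ρ) = 1 := by field_simp
  have h6 := mul_le_mul_of_nonneg_left h2 (by linarith : 0 ≤ ρ)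
  have h7 : ρ * (-(1 / ρ) * ∑ x, ∑ x', Q x * Q x' * dB W x x') =
    - ∑ x, ∑ x', Q x * Q x' * dB W x x' := by
    linear_combination (-∑ x, ∑ x', Q x * Q x' * dB W x x') * h5
  linarith

lemma aux_val_zero {X Y : Type} [Fintype X] [Fintype Y] (W : X → Y → ℝ) (hW : IsDMC W) (Q : X → ℝ)
    (hQ : IsProbDist Q) :
    0 ≤ -(1:ℝ) * ∑ x, Q x * Real.log (gfun W Q 1 (fun _ => 0) x) := by
  have : ∑ x, Q x * Real.log (gfun W Q 1 (fun _ => 0) x) ≤ 0 := by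
    apply Finset.sum_nonpos
    intro x _
    apply mul_nonpos_of_nonneg_of_nonpos (hQ.1 x)
    apply Real.log_nonpos (aux_gfun_pos W Q hQ _ _ _).le
    refine le_trans ?_ hQ.2.le
    unfold gfun
    apply Finset.sum_le_sum
    intro x' _
    apply mul_le_of_le_one_right (hQ.1 _)
    have := aux_dB_nonneg W hW x x'
    simp [this]
  linarith

lemma aux_Es {V : Type} [Fintype V] (PV : V → ℝ) (hPV : IsProbDist PV) (ρ : ℝ) (hρ : 1 ≤ ρ)
    (c : ℝ) (hc : c = Real.log (∑ v, PV v ^ ((1:ℝ)/2))) : (1 + ρ) * c ≤ Es PV ρ := by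
  have h1 : ∀ v, PV v ≤ 1 := fun v => by
    rw [← hPV.2]; exact Finset.single_le_sum (fun i _ => hPV.1 i) (Finset.mem_univ v)
  have hle : ∀ r : ℝ, 0 ≤ r → r ≤ 1/2 → ∑ v, PV v ^ ((1:ℝ)/2) ≤ ∑ v, PV v ^ r := fun r h0 hr =>
    Finset.sum_le_sum (fun v _ => Real.rpow_le_rpow_of_exponent_ge' (hPV.1 v) (h1 v) h0 hr)
  have hpos : 0 < ∑ v, PV v ^ ((1:ℝ)/2) := by
    have : ∑ v, PV v ≤ ∑ v, PV v ^ ((1:ℝ)/2) := Finset.sum_le_sum (fun v _ => by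
      simpa using Real.rpow_le_rpow_of_exponent_ge' (hPV.1 v) (h1 v)
        (by norm_num : (0:ℝ) ≤ 1/2) (by norm_num : (1:ℝ)/2 ≤ 1))
    rw [hPV.2] at this
    linarith
  rw [Es, hc]
  apply mul_le_mul_of_nonneg_left _ (by linarith)
  apply Real.log_le_log hpos
  apply hle _ (by positivity)
  rw [div_le_div_iff₀ (by linarith) (by norm_num)]
  linarith

lemma aux_poly (J : ℕ) (δ : ℝ) (hδ : 0 < δ) : ∃ n₀ : ℕ, ∀ n : ℕ, n₀ ≤ n →
    2 * (Real.exp 1 * ((n:ℝ) + 1)) ^ J ≤ Real.exp (n * δ) := by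
  have h := isLittleO_pow_exp_pos_mul_atTop J hδ
  have h2 := h.bound (show (0:ℝ) < 1 / (2 * Real.exp 1 ^ J * Real.exp δ) by positivity)
  have h3 : Filter.Tendsto (fun n : ℕ => ((n:ℝ) + 1)) Filter.atTop Filter.atTop :=
    Filter.tendsto_atTop_add_const_right _ _ tendsto_natCast_atTop_atTop
  obtain ⟨n₀, hn₀⟩ := Filter.eventually_atTop.1 (h3.eventually h2)
  refine ⟨n₀, fun n hn => ?_⟩
  have := hn₀ n hn
  rw [Real.norm_of_nonneg (by positivity), Real.norm_of_nonneg (by positivity),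
    show δ * ((n:ℝ) + 1) = n * δ + δ by ring, Real.exp_add] at this
  calc 2 * (Real.exp 1 * ((n:ℝ) + 1)) ^ J = 2 * Real.exp 1 ^ J * ((n:ℝ) + 1) ^ J := by
        rw [mul_pow]; ring
    _ ≤ 2 * Real.exp 1 ^ J * (1 / (2 * Real.exp 1 ^ J * Real.exp δ) *
        (Real.exp (n * δ) * Real.exp δ)) := by gcongr
    _ = _ := by field_simp

/-- Lemma 5, single class: for every composition `Q ∈ 𝒫ₙ(𝒳)` with
`|T^n(Q)| ≥ |𝒱^k|` there exists a code with all codewords in `T^n(Q)` and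
`p_e ≤ e^{nε} exp(-n sup_{ρ ≥ 1}{E_x(Q, ρ) - t E_s(ρ, P_V)})`. -/
theorem stmt12 {V X Y : Type} [Fintype V] [Fintype X] [Fintype Y]
    (PV : V → ℝ) (hPV : IsProbDist PV) (W : X → Y → ℝ) (hW : IsDMC W)
    (t : ℝ) (ht : 0 < t) (ε : ℝ) (hε : 0 < ε) :
    ∃ n₀ : ℕ, ∀ n : ℕ, n₀ ≤ n →
      ∀ Q : X → ℝ, IsType n Q →
        Fintype.card (Fin ⌊t * (n : ℝ)⌋₊ → V) ≤ (typeClass n Q).card →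
        ∃ (f : (Fin ⌊t * (n : ℝ)⌋₊ → V) → Fin n → X)
          (φ : (Fin n → Y) → Fin ⌊t * (n : ℝ)⌋₊ → V),
          (∀ v, f v ∈ typeClass n Q) ∧
          pErr PV W f φ ≤ Real.exp ((n : ℝ) * ε) *
            Real.exp (-(n : ℝ) *
              sSup { z | ∃ ρ : ℝ, 1 ≤ ρ ∧ z = Ex W Q ρ - t * Es PV ρ }) := by
  have hV : Nonempty V := by
    by_contra h
    rw [not_nonempty_iff] at h
    have := hPV.2
    simp at this
  have hP1 : ∀ v, PV v ≤ 1 := fun v => by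
    rw [← hPV.2]; exact Finset.single_le_sum (fun i _ => hPV.1 i) (Finset.mem_univ v)
  by_cases hdeg : ∃ v₀, PV v₀ = 1
  · -- deterministic source: zero error
    obtain ⟨v₀, hv₀⟩ := hdeg
    have hz : ∀ v, v ≠ v₀ → PV v = 0 := by
      intro v hv
      have h1 : PV v + PV v₀ ≤ ∑ v, PV v := by
        rw [← Finset.sum_pair hv]
        exact Finset.sum_le_sum_of_subset_of_nonneg (Finset.subset_univ _) (fun i _ _ => hPV.1 i)
      rw [hPV.2, hv₀] at h1
      linarith [hPV.1 v]
    refine ⟨0, fun n _ Q hQ _ => ?_⟩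
    obtain ⟨x₀, hx₀⟩ := hQ
    refine ⟨fun _ => x₀, fun _ _ => v₀, fun _ => by simp [typeClass, hx₀], ?_⟩
    refine le_trans (le_of_eq ?_) (by positivity : (0:ℝ) ≤ _)
    unfold pErr
    apply Finset.sum_eq_zero
    intro v _
    by_cases hv : (fun _ => v₀) = v
    · simp [hv]
    · have : ∃ i, v i ≠ v₀ := by
        by_contra hcon
        push Not at hcon
        exact hv (funext fun i => (hcon i).symm)
      obtain ⟨i, hi⟩ := this
      rw [prodDist, Finset.prod_eq_zero (Finset.mem_univ i) (hz _ hi), zero_mul]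
  · push Not at hdeg
    set c := Real.log (∑ v, PV v ^ ((1:ℝ)/2)) with hc
    have hc0 : 0 < c := by
      apply Real.log_pos
      refine lt_of_eq_of_lt hPV.2.symm ?_
      have hex : ∃ v, 0 < PV v := by
        by_contra hcon
        push Not at hcon
        have : ∑ v, PV v ≤ 0 := Finset.sum_nonpos (fun v _ => hcon v)
        rw [hPV.2] at this
        linarith
      obtain ⟨v, hv⟩ := hex
      refine Finset.sum_lt_sum (fun v _ => ?_) ⟨v, Finset.mem_univ _, ?_⟩
      · simpa using Real.rpow_le_rpow_of_exponent_ge' (hPV.1 v) (hP1 v)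
          (by norm_num : (0:ℝ) ≤ 1/2) (by norm_num : (1:ℝ)/2 ≤ 1)
      · simpa using Real.rpow_lt_rpow_of_exponent_gt hv ((hP1 v).lt_of_ne (hdeg v))
          (by norm_num : (1:ℝ)/2 < 1)
    set D := ∑ x, ∑ x', dB W x x' with hD
    obtain ⟨R, hR⟩ := exists_nat_ge ((D + t * Es PV 1) / (t * c))
    obtain ⟨n₀, hn₀⟩ := aux_poly (Fintype.card X * (R + 1)) (ε / 2) (by linarith)
    refine ⟨n₀ + 1, fun n hn Q hQ _ => ?_⟩
    have hn1 : 0 < n := by omega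
    have hQp : IsProbDist Q := by
      obtain ⟨x₀, rfl⟩ := hQ
      exact aux_empDist_prob hn1 x₀
    set s := sSup { z | ∃ ρ : ℝ, 1 ≤ ρ ∧ z = Ex W Q ρ - t * Es PV ρ } with hs
    have hchoice : ∃ ρ : ℝ, ∃ a : X → ℝ, 1 ≤ ρ ∧ ρ ≤ R + 1 ∧
        s - ε / 2 ≤ -ρ * ∑ x, Q x * Real.log (gfun W Q ρ a x) - t * Es PV ρ := by
      obtain ⟨z, ⟨ρ, hρ, hz⟩, hzs⟩ := exists_lt_of_lt_csSup
        (s := { z | ∃ ρ : ℝ, 1 ≤ ρ ∧ z = Ex W Q ρ - t * Es PV ρ })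
        ⟨_, 1, le_refl _, rfl⟩ (show s - ε / 4 < s by linarith)
      have hne : { z | ∃ a : X → ℝ,
          z = -ρ * ∑ x, Q x * Real.log (∑ x', Q x' *
            (Real.exp (-dB W x x') * Real.exp (a x' - a x)) ^ (1 / ρ)) }.Nonempty :=
        ⟨_, fun _ => 0, rfl⟩
      obtain ⟨u, ⟨a, hu⟩, hua⟩ := exists_lt_of_lt_csSup hne
        (show Ex W Q ρ - ε / 4 < Ex W Q ρ by linarith)
      have hu' : u = -ρ * ∑ x, Q x * Real.log (gfun W Q ρ a x) := hu
      by_cases hρR : ρ ≤ R + 1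
      · exact ⟨ρ, a, hρ, hρR, by rw [← hu']; linarith⟩
      · refine ⟨1, fun _ => 0, le_refl _, by linarith [Nat.cast_nonneg (α := ℝ) R], ?_⟩
        have h0 := aux_val_zero W hW Q hQp
        have hval := aux_val_le W hW Q hQp ρ hρ a
        have hEs := aux_Es PV hPV ρ hρ c hc
        rw [div_le_iff₀ (by positivity)] at hR
        push Not at hρR
        have h5 : (R:ℝ) * (t * c) ≤ t * ((1 + ρ) * c) := by
          have : (R:ℝ) * (t * c) ≤ (1 + ρ) * (t * c) :=
            mul_le_mul_of_nonneg_right (by linarith) (by positivity)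
          linarith
        have h6 := mul_le_mul_of_nonneg_left hEs ht.le
        linarith
    obtain ⟨ρ, a, hρ, hρR, hval⟩ := hchoice
    obtain ⟨f, φ, hf, hpe⟩ := aux_code PV hPV W hW hn1 ⌊t * (n : ℝ)⌋₊ Q hQ ρ hρ a
    refine ⟨f, φ, hf, hpe.trans ?_⟩
    set val := -ρ * ∑ x, Q x * Real.log (gfun W Q ρ a x) with hvaldef
    have hL : 2 * ((Real.exp 1 * ((n:ℝ) + 1)) ^ (Fintype.card X)) ^ ρ ≤ Real.exp (n * (ε / 2)) := by
      refine le_trans ?_ (hn₀ n (by omega))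
      rw [pow_mul]
      apply mul_le_mul_of_nonneg_left _ (by norm_num)
      rw [← Real.rpow_natCast _ (R + 1)]
      apply Real.rpow_le_rpow_of_exponent_le
      · apply one_le_pow₀
        have h1 := Real.exp_one_gt_d9
        have h2 : (0:ℝ) ≤ n := Nat.cast_nonneg n
        nlinarith
      · push_cast; exact hρR
    have hEs0 : 0 ≤ Es PV ρ := by
      have := aux_Es PV hPV ρ hρ c hc
      have h2 : 0 ≤ (1 + ρ) * c := by positivity
      linarith
    have hk : (⌊t * (n : ℝ)⌋₊ : ℝ) * Es PV ρ ≤ t * n * Es PV ρ :=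
      mul_le_mul_of_nonneg_right (Nat.floor_le (by positivity)) hEs0
    have hn' : (0:ℝ) ≤ n := Nat.cast_nonneg n
    calc _ ≤ Real.exp (n * (ε / 2)) * Real.exp (-n * val) * Real.exp (t * n * Es PV ρ) := by
          gcongr
      _ ≤ _ := by
          rw [← Real.exp_add, ← Real.exp_add, ← Real.exp_add, Real.exp_le_exp]
          have := mul_le_mul_of_nonneg_left hval hn'
          linarith

end
end

section
/- For every source type P ∈ 𝒫_k(𝒱) whose support is contained in that of P_V and every ρ ≥ 0: Σ_{v ∈ T^k(P)} P^k(v) · ( ∏_{l=1}^{k} P(v_l) )^{−ρ} ≤ (k+1)^{|𝒱|·ρ} · ( Σ_{v ∈ T^k(P)} P^k(v)^{1/(1+ρ)} )^{1+ρ}. -/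
open scoped Classical BigOperators

noncomputable section

def cntV {α : Type} {k : ℕ} (v : Fin k → α) (a : α) : ℕ :=
  (Finset.univ.filter fun i => v i = a).card

lemma sum_cntV {α : Type} [Fintype α] {k : ℕ} (v : Fin k → α) : ∑ a, cntV v a = k := by
  have h := Finset.card_eq_sum_card_fiberwise (f := v) (s := Finset.univ) (t := Finset.univ)
    (fun _ _ => by simp)
  simpa [cntV] using h.symm

lemma prod_comp_cntV {α M : Type} [Fintype α] [CommMonoid M] {k : ℕ} (f : α → M)
    (v : Fin k → α) : ∏ i, f (v i) = ∏ a, f a ^ cntV v a := by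
  rw [← Finset.prod_fiberwise' Finset.univ v f]
  simp [cntV]

lemma exists_perm_cntV {α : Type} [Fintype α] {k : ℕ} (v w : Fin k → α)
    (h : cntV v = cntV w) : ∃ τ : Equiv.Perm (Fin k), v = w ∘ τ := by
  have e : ∀ a, Nonempty ({i // v i = a} ≃ {i // w i = a}) := fun a => by
    refine ⟨Fintype.equivOfCardEq ?_⟩
    rw [Fintype.card_subtype, Fintype.card_subtype]
    exact congrFun h a
  refine ⟨(Equiv.sigmaFiberEquiv v).symm.trans ((Equiv.sigmaCongrRight fun a =>
    (e a).some).trans (Equiv.sigmaFiberEquiv w)), ?_⟩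
  funext i
  simp only [Function.comp_apply, Equiv.trans_apply]
  exact ((e (v i)).some ⟨i, rfl⟩).2.symm

lemma cntV_comp_perm {α : Type} {k : ℕ} (w : Fin k → α) (τ : Equiv.Perm (Fin k)) :
    cntV (w ∘ τ) = cntV w := by
  funext a
  unfold cntV
  apply Finset.card_bij (fun i _ => τ i)
  · simp
  · intro a _ b _ h
    exact τ.injective h
  · intro b hb
    exact ⟨τ.symm b, by simpa using hb, by simp⟩

lemma card_class_mul {α : Type} [Fintype α] {k : ℕ} (w : Fin k → α) :
    (Finset.univ.filter fun v : Fin k → α => cntV v = cntV w).card *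
      ∏ a, (cntV w a).factorial = k.factorial := by
  have hst : (Finset.univ.filter fun g : Equiv.Perm (Fin k) => w ∘ g = w).card
      = ∏ a, (cntV w a).factorial := by
    have h := DomMulAct.stabilizer_card w
    rw [Fintype.card_subtype] at h
    simp only [Fintype.card_subtype] at h
    exact h
  have h := Finset.card_eq_sum_card_fiberwise (f := fun g : Equiv.Perm (Fin k) => w ∘ g)
    (s := Finset.univ) (t := Finset.univ.filter fun v : Fin k → α => cntV v = cntV w)
    (fun g _ => by simp [cntV_comp_perm])
  rw [Finset.card_univ, Fintype.card_perm, Fintype.card_fin] at h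
  rw [h, Finset.sum_const_nat]
  intro v hv
  obtain ⟨τ, rfl⟩ := exists_perm_cntV v w (by simpa using hv)
  rw [← hst]
  apply Finset.card_bij (fun g _ => g * τ⁻¹)
  · intro g hg
    simp only [Finset.mem_filter, Finset.mem_univ, true_and] at hg ⊢
    funext i
    have := congrFun hg (τ⁻¹ i)
    simpa using this
  · intro a _ b _ h
    exact mul_right_cancel h
  · intro g hg
    refine ⟨g * τ, ?_, by simp⟩
    simp only [Finset.mem_filter, Finset.mem_univ, true_and] at hg ⊢
    funext i
    exact congrFun hg (τ i)

lemma fact_pow_le (n m : ℕ) : n.factorial * n ^ m ≤ m.factorial * n ^ n := by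
  rcases le_total n m with h | h
  · calc n.factorial * n ^ m = (n.factorial * n ^ (m - n)) * n ^ n := by
          rw [mul_assoc, ← pow_add, Nat.sub_add_cancel h]
      _ ≤ _ := Nat.mul_le_mul_right _ (Nat.factorial_mul_pow_sub_le_factorial h)
  · have h2 : n.factorial ≤ m.factorial * n ^ (n - m) := by
      have := Nat.factorial_mul_descFactorial (n := n) (k := n - m) (Nat.sub_le _ _)
      rw [Nat.sub_sub_self h] at this
      rw [← this]
      exact Nat.mul_le_mul_left _ (Nat.descFactorial_le_pow _ _)
    calc n.factorial * n ^ m ≤ (m.factorial * n ^ (n - m)) * n ^ m := Nat.mul_le_mul_right _ h2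
      _ = _ := by rw [mul_assoc, ← pow_add, Nat.sub_add_cancel h]

lemma class_mode {α : Type} [Fintype α] {k : ℕ} (u w : Fin k → α) :
    (Finset.univ.filter fun v : Fin k → α => cntV v = cntV u).card *
        ∏ a, cntV w a ^ cntV u a
      ≤ (Finset.univ.filter fun v : Fin k → α => cntV v = cntV w).card *
        ∏ a, cntV w a ^ cntV w a := by
  have hu := card_class_mul u
  have hw := card_class_mul w
  set A := (Finset.univ.filter fun v : Fin k → α => cntV v = cntV u).card
  set B := (Finset.univ.filter fun v : Fin k → α => cntV v = cntV w).card
  have hp : (∏ a, (cntV w a).factorial) * ∏ a, cntV w a ^ cntV u a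
      ≤ (∏ a, (cntV u a).factorial) * ∏ a, cntV w a ^ cntV w a := by
    rw [← Finset.prod_mul_distrib, ← Finset.prod_mul_distrib]
    exact Finset.prod_le_prod' fun a _ => fact_pow_le _ _
  have pu : 0 < ∏ a, (cntV u a).factorial := Finset.prod_pos fun a _ => Nat.factorial_pos _
  set X := ∏ a, (cntV u a).factorial
  set Y := ∏ a, (cntV w a).factorial
  set S := ∏ a, cntV w a ^ cntV u a
  set T := ∏ a, cntV w a ^ cntV w a
  refine Nat.le_of_mul_le_mul_left ?_ pu
  calc X * (A * S) = (A * X) * S := by ring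
    _ = B * (Y * S) := by rw [hu, ← hw]; ring
    _ ≤ B * (X * T) := Nat.mul_le_mul_left _ hp
    _ = _ := by ring

lemma class_lower {α : Type} [Fintype α] {k : ℕ} (w : Fin k → α) :
    k ^ k ≤ (k + 1) ^ Fintype.card α *
      ((Finset.univ.filter fun v : Fin k → α => cntV v = cntV w).card *
        ∏ a, cntV w a ^ cntV w a) := by
  have h1 : k ^ k = ∑ v : Fin k → α, ∏ i, cntV w (v i) := by
    have := Finset.prod_univ_sum (fun _ : Fin k => (Finset.univ : Finset α))
      (fun _ a => cntV w a)
    simpa [sum_cntV] using this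
  have hlt : ∀ (v : Fin k → α) a, cntV v a < k + 1 := fun v a => by
    have := Finset.card_le_univ (Finset.univ.filter fun i => v i = a)
    simp only [Fintype.card_fin] at this
    exact Nat.lt_succ_of_le this
  let F : (Fin k → α) → (α → Fin (k+1)) := fun v a => ⟨cntV v a, hlt v a⟩
  rw [h1, ← Finset.sum_fiberwise Finset.univ F]
  have hc : (k + 1) ^ Fintype.card α = (Finset.univ : Finset (α → Fin (k+1))).card := by
    simp
  rw [hc, ← smul_eq_mul]
  apply Finset.sum_le_card_nsmul
  intro m _
  by_cases hm : ∃ u, F u = m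
  · obtain ⟨u, rfl⟩ := hm
    have hF : ∀ v, F v = F u ↔ cntV v = cntV u := fun v => by
      simp [F, funext_iff]
    refine le_trans (le_of_eq ?_) (class_mode u w)
    simp only [hF]
    rw [Finset.sum_const_nat]
    intro v hv
    rw [prod_comp_cntV, (Finset.mem_filter.mp hv).2]
  · rw [Finset.filter_false_of_mem]
    · simp
    · intro v _ hv
      exact hm ⟨v, hv⟩

/-- per-type source sum bound: for every source type `P ∈ 𝒫ₖ(𝒱)`
supported in the support of `P_V` and every `ρ ≥ 0`,
`Σ_{v ∈ T^k(P)} P^k(v) (∏_l P(v_l))^{-ρ}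
  ≤ (k+1)^{|𝒱|ρ} (Σ_{v ∈ T^k(P)} P^k(v)^{1/(1+ρ)})^{1+ρ}`. -/
theorem stmt18 {V : Type} [Fintype V]
    (PV : V → ℝ) (hPV : IsProbDist PV)
    (k : ℕ) (P : V → ℝ) (hP : IsType k P) (hsupp : ∀ v, PV v = 0 → P v = 0)
    (ρ : ℝ) (hρ : 0 ≤ ρ) :
    ∑ v ∈ typeClass k P, prodDist PV v * prodDist P v ^ (-ρ)
      ≤ ((k : ℝ) + 1) ^ ((Fintype.card V : ℝ) * ρ) *
        (∑ v ∈ typeClass k P, prodDist PV v ^ (1 / (1 + ρ))) ^ (1 + ρ) := by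
  obtain ⟨w, rfl⟩ := hP
  have hmem : ∀ v : Fin k → V, v ∈ typeClass k (empDist w) ↔ cntV v = cntV w := by
    intro v
    simp only [typeClass, Finset.mem_filter, Finset.mem_univ, true_and]
    constructor
    · intro h
      funext a
      rcases Nat.eq_zero_or_pos k with rfl | hk
      · simp [cntV]
      · have h2 := congrFun h a
        have hk' : (k : ℝ) ≠ 0 := by positivity
        simp only [empDist] at h2
        rw [div_left_inj' hk'] at h2
        exact_mod_cast h2
    · intro h
      funext a
      have h2 := congrFun h a
      simp only [cntV] at h2
      simp only [empDist, h2]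
  have hT : typeClass k (empDist w) =
      Finset.univ.filter fun v : Fin k → V => cntV v = cntV w := by
    ext v
    simp [hmem]
  have hcp : ∀ (f : V → ℝ), ∀ v ∈ typeClass k (empDist w), prodDist f v = prodDist f w := by
    intro f v hv
    unfold prodDist
    rw [prod_comp_cntV, prod_comp_cntV, (hmem v).1 hv]
  have hq : prodDist (empDist w) w = (∏ a, (cntV w a : ℝ) ^ cntV w a) / (k : ℝ) ^ k := by
    have : prodDist (empDist w) w = ∏ i, ((cntV w (w i) : ℝ) / k) := rfl
    rw [this, Finset.prod_div_distrib, prod_comp_cntV (fun a => (cntV w a : ℝ))]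
    simp
  have hlow := class_lower w
  rw [← hT] at hlow
  have hlowR : (k : ℝ) ^ k ≤ ((k : ℝ) + 1) ^ Fintype.card V *
      (((typeClass k (empDist w)).card : ℝ) * ∏ a, (cntV w a : ℝ) ^ cntV w a) := by
    exact_mod_cast hlow
  have hkk : (0 : ℝ) < (k : ℝ) ^ k := by
    rcases Nat.eq_zero_or_pos k with rfl | hk
    · simp
    · positivity
  rw [Finset.sum_congr rfl (fun v hv => by rw [hcp PV v hv, hcp (empDist w) v hv]),
    Finset.sum_congr (s₁ := typeClass k (empDist w))
      (f := fun v => prodDist PV v ^ (1 / (1 + ρ))) (g := fun _ => prodDist PV w ^ (1 / (1 + ρ)))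
      rfl (fun v hv => by rw [hcp PV v hv])]
  rw [Finset.sum_const, Finset.sum_const, nsmul_eq_mul, nsmul_eq_mul]
  have hN : (0 : ℝ) < ((typeClass k (empDist w)).card : ℝ) := by
    exact_mod_cast Finset.card_pos.mpr ⟨w, (hmem w).2 rfl⟩
  have hp : 0 ≤ prodDist PV w := Finset.prod_nonneg fun i _ => hPV.1 _
  set N : ℝ := ((typeClass k (empDist w)).card : ℝ)
  set p := prodDist PV w
  set q := prodDist (empDist w) w
  set C : ℝ := ((k : ℝ) + 1) ^ Fintype.card V with hC
  have hC0 : 0 < C := by positivity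
  have h1 : 1 ≤ C * N * q := by
    rw [hq, ← mul_div_assoc, le_div_iff₀ hkk]
    linarith
  have hq0 : 0 < q := by
    by_contra hcon
    have : C * N * q ≤ 0 := mul_nonpos_of_nonneg_of_nonpos (by positivity) (not_lt.mp hcon)
    linarith
  have h2 : q ^ (-ρ) ≤ (C * N) ^ ρ := by
    rw [Real.rpow_neg hq0.le, ← Real.inv_rpow hq0.le]
    apply Real.rpow_le_rpow (by positivity) _ hρ
    rw [inv_le_iff_one_le_mul₀ hq0]
    exact h1
  have h3 : ((k : ℝ) + 1) ^ ((Fintype.card V : ℝ) * ρ) = C ^ ρ := by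
    rw [Real.rpow_mul (by positivity), Real.rpow_natCast]
  have h4 : (N * p ^ (1 / (1 + ρ))) ^ (1 + ρ) = N * N ^ ρ * p := by
    rw [Real.mul_rpow hN.le (by positivity), ← Real.rpow_mul hp,
      one_div_mul_cancel (by positivity), Real.rpow_one, Real.rpow_add hN, Real.rpow_one]
  rw [h3, h4]
  calc N * (p * q ^ (-ρ)) ≤ N * (p * (C * N) ^ ρ) := by gcongr
    _ = _ := by
      rw [Real.mul_rpow hC0.le hN.le]
      ring

end
end
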